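/- Let 0 < α < 1, let μ, h, n be real numbers with n ≥ 1, let u₀(x) = tanh(x/√2) and u₁(x,t) = −(h μ sech²(x/√2)/(√2 Γ(α+1))) t^{α}. Define u₂(x,t) = n u₁(x,t) + h J^α[ D_t^α u₁ − μ ∂ₓu₁ − 12 u₀ u₀′ ∂ₓu₁ − 6 u₁ (u₀′)² − 6 u₀ u₁ u₀″ − 3 u₀² ∂ₓ²u₁ + ∂ₓ²u₁ + ∂ₓ⁴u₁ ](x,t), where J^α and the Caputo derivative D_t^α act in the t-variable. Then for every real x and every t > 0, u₂(x,t) = (n+h) u₁(x,t) − (h² μ² tanh(x/√2) sech²(x/√2) / Γ(2α+1)) t^{2α}. -/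

import Mathlib

theorem aux_kernel (a b t : ℝ) (ha : 0 < a) (hb : 0 < b) (ht : 0 < t) :
    ∫ s in (0:ℝ)..t, (t - s) ^ (a - 1) * s ^ (b - 1)
      = Real.Gamma a * Real.Gamma b / Real.Gamma (a + b) * t ^ (a + b - 1) := by
  have h1 := Complex.betaIntegral_scaled (b : ℂ) (a : ℂ) ht
  rw [Complex.betaIntegral_eq_Gamma_mul_div _ _ (by simpa using hb) (by simpa using ha)] at h1
  have h2 : ∫ x in (0:ℝ)..t, (x : ℂ) ^ ((b : ℂ) - 1) * ((t : ℂ) - x) ^ ((a : ℂ) - 1)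
      = ∫ x in (0:ℝ)..t, (((t - x) ^ (a - 1) * x ^ (b - 1) : ℝ) : ℂ) := by
    apply intervalIntegral.integral_congr
    intro x hx
    rw [Set.uIcc_of_le ht.le] at hx
    simp only
    rw [Complex.ofReal_mul, Complex.ofReal_cpow (by linarith [hx.2]), Complex.ofReal_cpow hx.1]
    push_cast
    ring
  rw [h2, intervalIntegral.integral_ofReal, ← Complex.ofReal_add, Complex.Gamma_ofReal,
    Complex.Gamma_ofReal, Complex.Gamma_ofReal, ← Complex.ofReal_one, ← Complex.ofReal_sub,
    ← Complex.ofReal_cpow ht.le] at h1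
  have h3 : (∫ s in (0:ℝ)..t, (t - s) ^ (a - 1) * s ^ (b - 1))
      = t ^ (b + a - 1) * (Real.Gamma b * Real.Gamma a / Real.Gamma (b + a)) := by
    exact_mod_cast h1
  rw [h3, add_comm b a]
  ring

theorem aux_integrable (a b t : ℝ) (ha : 0 < a) (hb : 0 < b) (ht : 0 < t) :
    IntervalIntegrable (fun s : ℝ => (t - s) ^ (a - 1) * s ^ (b - 1))
      MeasureTheory.volume 0 t := by
  apply intervalIntegral.intervalIntegrable_of_integral_ne_zero
  rw [aux_kernel a b t ha hb ht]
  have h1 := Real.Gamma_pos_of_pos ha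
  have h2 := Real.Gamma_pos_of_pos hb
  have h3 := Real.Gamma_pos_of_pos (add_pos ha hb)
  positivity

theorem aux_sech (x : ℝ) : (1 / Real.cosh x) ^ 2 = 1 - Real.tanh x ^ 2 := by
  have := Real.cosh_pos x
  have h := Real.cosh_sq x
  rw [Real.tanh_eq_sinh_div_cosh]
  field_simp
  linarith

theorem aux_tanh (x : ℝ) : HasDerivAt (fun y => Real.tanh (y / Real.sqrt 2))
    ((1 - Real.tanh (x / Real.sqrt 2) ^ 2) / Real.sqrt 2) x := by
  have hc := (Real.cosh_pos (x / Real.sqrt 2)).ne'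
  have h0 : HasDerivAt (fun y : ℝ => y / Real.sqrt 2) (1 / Real.sqrt 2) x :=
    (hasDerivAt_id x).div_const _
  have h1 := (h0.sinh).div (h0.cosh) hc
  have e : (fun y => Real.tanh (y / Real.sqrt 2))
      = fun y => Real.sinh (y / Real.sqrt 2) / Real.cosh (y / Real.sqrt 2) := by
    funext y; rw [Real.tanh_eq_sinh_div_cosh]
  rw [e, Real.tanh_eq_sinh_div_cosh]
  refine h1.congr_deriv ?_
  have hs : Real.sqrt 2 ≠ 0 := by positivity
  field_simp

/-- Derivative of a polynomial of degree at most five in tanh. -/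
theorem aux_poly (c0 c1 c2 c3 c4 c5 x : ℝ) :
    deriv (fun y => c0 + c1 * Real.tanh (y / Real.sqrt 2) + c2 * Real.tanh (y / Real.sqrt 2) ^ 2
      + c3 * Real.tanh (y / Real.sqrt 2) ^ 3 + c4 * Real.tanh (y / Real.sqrt 2) ^ 4
      + c5 * Real.tanh (y / Real.sqrt 2) ^ 5) x
    = (c1 + 2 * c2 * Real.tanh (x / Real.sqrt 2) + 3 * c3 * Real.tanh (x / Real.sqrt 2) ^ 2
      + 4 * c4 * Real.tanh (x / Real.sqrt 2) ^ 3 + 5 * c5 * Real.tanh (x / Real.sqrt 2) ^ 4)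
      * ((1 - Real.tanh (x / Real.sqrt 2) ^ 2) / Real.sqrt 2) := by
  have h := aux_tanh x
  have := ((((((hasDerivAt_const x c0).add (h.const_mul c1)).add ((h.pow 2).const_mul c2)).add
    ((h.pow 3).const_mul c3)).add ((h.pow 4).const_mul c4)).add ((h.pow 5).const_mul c5))
  refine (this.congr_deriv ?_).deriv
  norm_num
  ring

theorem aux_sq : (Real.sqrt 2)⁻¹ ^ 2 = 1 / 2 := by
  rw [inv_pow, Real.sq_sqrt (by norm_num)]; norm_num

theorem aux_d1 (C : ℝ) :
    deriv (fun y => C * (1 - Real.tanh (y / Real.sqrt 2) ^ 2))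
      = fun x => C * (-2 * Real.tanh (x / Real.sqrt 2)
          * (1 - Real.tanh (x / Real.sqrt 2) ^ 2) / Real.sqrt 2) := by
  funext x
  have := aux_poly C 0 (-C) 0 0 0 x
  convert this using 1
  · congr 1; funext y; ring
  · ring

theorem aux_d2 (C : ℝ) :
    deriv (fun x => C * (-2 * Real.tanh (x / Real.sqrt 2)
          * (1 - Real.tanh (x / Real.sqrt 2) ^ 2) / Real.sqrt 2))
      = fun x => C * (-1 + 4 * Real.tanh (x / Real.sqrt 2) ^ 2
          - 3 * Real.tanh (x / Real.sqrt 2) ^ 4) := by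
  funext x
  have := aux_poly 0 (-2 * C / Real.sqrt 2) 0 (2 * C / Real.sqrt 2) 0 0 x
  convert this using 1
  · congr 1; funext y; ring
  · have := aux_sq
    ring_nf
    rw [this]
    ring

theorem aux_d3 (C : ℝ) :
    deriv (fun x => C * (-1 + 4 * Real.tanh (x / Real.sqrt 2) ^ 2
          - 3 * Real.tanh (x / Real.sqrt 2) ^ 4))
      = fun x => C * (8 * Real.tanh (x / Real.sqrt 2) - 20 * Real.tanh (x / Real.sqrt 2) ^ 3
          + 12 * Real.tanh (x / Real.sqrt 2) ^ 5) / Real.sqrt 2 := by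
  funext x
  have := aux_poly (-C) 0 (4 * C) 0 (-3 * C) 0 x
  convert this using 1
  · congr 1; funext y; ring
  · ring

theorem aux_d4 (C : ℝ) :
    deriv (fun x => C * (8 * Real.tanh (x / Real.sqrt 2) - 20 * Real.tanh (x / Real.sqrt 2) ^ 3
          + 12 * Real.tanh (x / Real.sqrt 2) ^ 5) / Real.sqrt 2)
      = fun x => C * ((4 - 30 * Real.tanh (x / Real.sqrt 2) ^ 2
          + 30 * Real.tanh (x / Real.sqrt 2) ^ 4) * (1 - Real.tanh (x / Real.sqrt 2) ^ 2)) := by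
  funext x
  have := aux_poly 0 (8 * C / Real.sqrt 2) 0 (-20 * C / Real.sqrt 2) 0 (12 * C / Real.sqrt 2) x
  convert this using 1
  · congr 1; funext y; ring
  · have := aux_sq
    ring_nf
    rw [this]
    ring

theorem aux_space (C x : ℝ) (u₀ f : ℝ → ℝ) (hu : u₀ = fun x => Real.tanh (x / Real.sqrt 2))
    (hf : f = fun y => C * (1 - Real.tanh (y / Real.sqrt 2) ^ 2)) :
    - 12 * u₀ x * deriv u₀ x * deriv f x
          - 6 * f x * (deriv u₀ x) ^ 2
          - 6 * u₀ x * f x * iteratedDeriv 2 u₀ x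
          - 3 * (u₀ x) ^ 2 * iteratedDeriv 2 f x
          + iteratedDeriv 2 f x
          + iteratedDeriv 4 f x = 0 := by
  have e0 : deriv u₀ = fun x => (Real.sqrt 2)⁻¹ * (1 - Real.tanh (x / Real.sqrt 2) ^ 2) := by
    funext y
    rw [hu, (aux_tanh y).deriv]
    ring
  have e1 : iteratedDeriv 2 u₀ x = (Real.sqrt 2)⁻¹ * (-2 * Real.tanh (x / Real.sqrt 2)
          * (1 - Real.tanh (x / Real.sqrt 2) ^ 2) / Real.sqrt 2) := by
    simp only [iteratedDeriv_succ, iteratedDeriv_zero]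
    rw [e0, aux_d1]
  have e2 : iteratedDeriv 2 f x = C * (-1 + 4 * Real.tanh (x / Real.sqrt 2) ^ 2
          - 3 * Real.tanh (x / Real.sqrt 2) ^ 4) := by
    simp only [iteratedDeriv_succ, iteratedDeriv_zero]
    rw [hf, aux_d1, aux_d2]
  have e4 : iteratedDeriv 4 f x = C * ((4 - 30 * Real.tanh (x / Real.sqrt 2) ^ 2
          + 30 * Real.tanh (x / Real.sqrt 2) ^ 4) * (1 - Real.tanh (x / Real.sqrt 2) ^ 2)) := by
    simp only [iteratedDeriv_succ, iteratedDeriv_zero]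
    rw [hf, aux_d1, aux_d2, aux_d3, aux_d4]
  rw [e1, e2, e4, e0, hf, aux_d1, hu]
  have := aux_sq
  simp only [div_eq_mul_inv] at *
  generalize (Real.sqrt 2)⁻¹ = r at *
  generalize Real.tanh (x * r) = T
  ring_nf
  rw [this]
  ring

theorem aux_caputo (α C s : ℝ) (hα0 : 0 < α) (hα1 : α < 1) (hs : 0 < s) (g : ℝ → ℝ)
    (hg : g = fun τ => C * τ ^ α) :
    (1 / Real.Gamma (1 - α)) * (∫ ξ in (0:ℝ)..s, (s - ξ) ^ (-α) * deriv g ξ)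
      = C * Real.Gamma (α + 1) := by
  have e : ∫ ξ in (0:ℝ)..s, (s - ξ) ^ (-α) * deriv g ξ
      = ∫ ξ in (0:ℝ)..s, (C * α) * ((s - ξ) ^ ((1 - α) - 1) * ξ ^ (α - 1)) := by
    apply intervalIntegral.integral_congr_ae
    refine Filter.Eventually.of_forall fun ξ hξ => ?_
    rw [Set.uIoc_of_le hs.le] at hξ
    have : deriv g ξ = C * (α * ξ ^ (α - 1)) := by
      rw [hg]
      exact ((Real.hasDerivAt_rpow_const (Or.inl hξ.1.ne')).const_mul C).deriv
    rw [this, show 1 - α - 1 = -α by ring]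
    ring
  have hG := Real.Gamma_pos_of_pos (show 0 < 1 - α by linarith)
  rw [e, intervalIntegral.integral_const_mul, aux_kernel (1 - α) α s (by linarith) hα0 hs,
    show 1 - α + α = 1 by ring, Real.Gamma_one, Real.Gamma_add_one hα0.ne', sub_self,
    Real.rpow_zero]
  field_simp

/-- Second q-HAM iterate for the fourth-order time-fractional Cahn–Hilliard equation
with initial datum `tanh(x/√2)`:
`u₂ = (n+h)u₁ − (h²μ² tanh(x/√2) sech²(x/√2)/Γ(2α+1)) t^{2α}`. -/
theorem stmt_9 (α μ h n : ℝ) (hα0 : 0 < α) (hα1 : α < 1) (hn : 1 ≤ n)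
    (u₀ : ℝ → ℝ) (hu₀ : ∀ x, u₀ x = Real.tanh (x / Real.sqrt 2))
    (u₁ : ℝ → ℝ → ℝ)
    (hu₁ : ∀ x t, u₁ x t =
      -(h * μ * (1 / Real.cosh (x / Real.sqrt 2)) ^ 2
          / (Real.sqrt 2 * Real.Gamma (α + 1))) * t ^ α)
    (u₂ : ℝ → ℝ → ℝ)
    (hu₂ : ∀ x t, u₂ x t = n * u₁ x t + h *
      ((1 / Real.Gamma α) * ∫ s in (0:ℝ)..t, (t - s) ^ (α - 1) *
        ((1 / Real.Gamma (1 - α)) *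
            (∫ ξ in (0:ℝ)..s, (s - ξ) ^ (-α) * deriv (fun τ => u₁ x τ) ξ)
          - μ * deriv (fun y => u₁ y s) x
          - 12 * u₀ x * deriv u₀ x * deriv (fun y => u₁ y s) x
          - 6 * u₁ x s * (deriv u₀ x) ^ 2
          - 6 * u₀ x * u₁ x s * iteratedDeriv 2 u₀ x
          - 3 * (u₀ x) ^ 2 * iteratedDeriv 2 (fun y => u₁ y s) x
          + iteratedDeriv 2 (fun y => u₁ y s) x
          + iteratedDeriv 4 (fun y => u₁ y s) x))) :
    ∀ (x t : ℝ), 0 < t →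
      u₂ x t = (n + h) * u₁ x t
        - h ^ 2 * μ ^ 2 * Real.tanh (x / Real.sqrt 2)
            * (1 / Real.cosh (x / Real.sqrt 2)) ^ 2
            / Real.Gamma (2 * α + 1) * t ^ (2 * α) := by
  intro x t ht
  have hG1 := Real.Gamma_pos_of_pos (show 0 < α + 1 by linarith)
  have hGα := Real.Gamma_pos_of_pos hα0
  have hG2 := Real.Gamma_pos_of_pos (show 0 < 2 * α + 1 by linarith)
  have hs2 : Real.sqrt 2 ≠ 0 := by positivity
  have hq := aux_sq
  set T := Real.tanh (x / Real.sqrt 2) with hT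
  have hu0 : u₀ = fun x => Real.tanh (x / Real.sqrt 2) := funext hu₀
  have hx : ∀ s, (fun y => u₁ y s) = fun y =>
      (-(h * μ / (Real.sqrt 2 * Real.Gamma (α + 1))) * s ^ α)
        * (1 - Real.tanh (y / Real.sqrt 2) ^ 2) := by
    intro s; funext y; rw [hu₁, aux_sech]; ring
  have htm : (fun τ => u₁ x τ) = fun τ =>
      (-(h * μ * (1 - T ^ 2) / (Real.sqrt 2 * Real.Gamma (α + 1)))) * τ ^ α := by
    funext τ; rw [hu₁, aux_sech]
  have key : ∫ s in (0:ℝ)..t, (t - s) ^ (α - 1) *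
        ((1 / Real.Gamma (1 - α)) *
            (∫ ξ in (0:ℝ)..s, (s - ξ) ^ (-α) * deriv (fun τ => u₁ x τ) ξ)
          - μ * deriv (fun y => u₁ y s) x
          - 12 * u₀ x * deriv u₀ x * deriv (fun y => u₁ y s) x
          - 6 * u₁ x s * (deriv u₀ x) ^ 2
          - 6 * u₀ x * u₁ x s * iteratedDeriv 2 u₀ x
          - 3 * (u₀ x) ^ 2 * iteratedDeriv 2 (fun y => u₁ y s) x
          + iteratedDeriv 2 (fun y => u₁ y s) x
          + iteratedDeriv 4 (fun y => u₁ y s) x)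
      = ∫ s in (0:ℝ)..t, ((-(h * μ * (1 - T ^ 2) / Real.sqrt 2)) *
            ((t - s) ^ (α - 1) * s ^ ((1:ℝ) - 1))
          + (-(h * μ ^ 2 * T * (1 - T ^ 2) / Real.Gamma (α + 1))) *
            ((t - s) ^ (α - 1) * s ^ ((α + 1) - 1))) := by
    apply intervalIntegral.integral_congr_ae
    refine Filter.Eventually.of_forall fun s hs => ?_
    rw [Set.uIoc_of_le ht.le] at hs
    have h1 := aux_caputo α _ s hα0 hα1 hs.1 _ htm
    have h2 := aux_space _ x u₀ _ hu0 (hx s)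
    have h3 : deriv (fun y => u₁ y s) x = h * μ * T * (1 - T ^ 2) / Real.Gamma (α + 1) * s ^ α := by
      rw [hx s, aux_d1]
      simp only [← hT]
      have h5 : Real.sqrt 2 ^ 2 = 2 := Real.sq_sqrt (by norm_num)
      field_simp
      rw [h5]
      ring
    have h4 : -(h * μ * (1 - T ^ 2) / (Real.sqrt 2 * Real.Gamma (α + 1))) * Real.Gamma (α + 1)
        = -(h * μ * (1 - T ^ 2) / Real.sqrt 2) := by
      field_simp
    rw [h4] at h1
    rw [h1, show (1:ℝ) - 1 = 0 by ring, Real.rpow_zero, show α + 1 - 1 = α by ring]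
    have h6 : μ * deriv (fun y => u₁ y s) x
        = μ * (h * μ * T * (1 - T ^ 2) / Real.Gamma (α + 1) * s ^ α) := by rw [h3]
    linear_combination (t - s) ^ (α - 1) * h2 - (t - s) ^ (α - 1) * h6
  rw [hu₂, key, intervalIntegral.integral_add
    ((aux_integrable α 1 t hα0 one_pos ht).const_mul _)
    ((aux_integrable α (α + 1) t hα0 (by linarith) ht).const_mul _),
    intervalIntegral.integral_const_mul, intervalIntegral.integral_const_mul,
    aux_kernel α 1 t hα0 one_pos ht, aux_kernel α (α + 1) t hα0 (by linarith) ht,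
    hu₁, aux_sech, ← hT, Real.Gamma_one, show α + 1 - 1 = α by ring,
    show α + (α + 1) = 2 * α + 1 by ring, show 2 * α + 1 - 1 = 2 * α by ring]
  field_simp
  ring
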